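/- Let (q_n)_{n≥1} be a sequence of reals with 0 < q_n ≤ 1, assume that for every y ∈ (0,1) the series Σ_{n=3}^∞ sup_{0≤x≤1} M_n^{q_n}((t−x)²)(x) · yⁿ converges, where M_n^{q_n}((t−x)²)(x) denotes the operator M_n^{q_n} applied at the point x to the function t ↦ (t−x)², and define φ(y) = ((1−y) · sup_{0≤x≤1} Σ_{n=3}^∞ M_n^{q_n}((t−x)²)(x) yⁿ)^{1/2}; assume φ(y) > 0 for all y ∈ (0,1). Let μ : (0,1) → (0,∞) and let f ∈ C[0,1]. If ω(f, φ(y))/μ(y) → 0 as y → 1⁻, then (1−y) · sup_{0≤x≤1} |Σ_{n=3}^∞ (M_n^{q_n}(f)(x) − f(x)) yⁿ| / μ(y) → 0 as y → 1⁻. -/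

import Mathlib

open Filter Topology

/-- The `q`-integer `[n]_q = 1 + q + ⋯ + q^{n-1}`. -/
noncomputable def qInt (q : ℝ) (n : ℕ) : ℝ := ∑ k ∈ Finset.range n, q ^ k

/-- The `q`-factorial `[n]_q!`. -/
noncomputable def qFact (q : ℝ) (n : ℕ) : ℝ := ∏ k ∈ Finset.range n, qInt q (k + 1)

/-- The `q`-binomial coefficient `[m choose r]_q`. -/
noncomputable def qBinom (q : ℝ) (m r : ℕ) : ℝ := qFact q m / (qFact q r * qFact q (m - r))

/-- The `q`-Meyer–König–Zeller operator. -/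
noncomputable def MKZ (q : ℝ) (n : ℕ) (f : ℝ → ℝ) (x : ℝ) : ℝ :=
  if x = 1 then f 1
  else (∏ j ∈ Finset.range (n + 1), (1 - q ^ j * x)) *
    ∑' k : ℕ, f (qInt q k / qInt q (n + k)) * qBinom q (n + k) k * x ^ k

/-- The modulus of continuity of `f` on `[0,1]`. -/
noncomputable def modulus (f : ℝ → ℝ) (δ : ℝ) : ℝ :=
  sSup {z : ℝ | ∃ x y : ℝ, x ∈ Set.Icc (0 : ℝ) 1 ∧ y ∈ Set.Icc (0 : ℝ) 1 ∧
    |x - y| ≤ δ ∧ z = |f x - f y|}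

/-- `φ(y) = ((1-y) · sup_x Σ_{n≥3} M_n^{q_n}((t-x)²)(x) yⁿ)^{1/2}`. -/
noncomputable def phiM (q : ℕ → ℝ) (y : ℝ) : ℝ :=
  Real.sqrt ((1 - y) * ⨆ x : Set.Icc (0 : ℝ) 1,
    ∑' n : ℕ, MKZ (q (n + 3)) (n + 3) (fun t => (t - (x : ℝ)) ^ 2) x * y ^ (n + 3))

section

open Set

theorem qInt_pos {q : ℝ} (hq : 0 < q) (n : ℕ) : 0 < qInt q (n + 1) :=
  Finset.sum_pos (fun k _ => pow_pos hq k) ⟨0, by simp⟩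

theorem qInt_nonneg {q : ℝ} (hq : 0 < q) (n : ℕ) : 0 ≤ qInt q n :=
  Finset.sum_nonneg fun k _ => (pow_pos hq k).le

theorem qInt_add (q : ℝ) (m n : ℕ) : qInt q (m + n) = qInt q m + q ^ m * qInt q n := by
  simp [qInt, Finset.sum_range_add, Finset.mul_sum, pow_add]

theorem qFact_pos {q : ℝ} (hq : 0 < q) (n : ℕ) : 0 < qFact q n :=
  Finset.prod_pos fun k _ => qInt_pos hq k

theorem qFact_succ (q : ℝ) (n : ℕ) : qFact q (n + 1) = qFact q n * qInt q (n + 1) :=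
  Finset.prod_range_succ _ _

theorem qBinom_nonneg {q : ℝ} (hq : 0 < q) (m r : ℕ) : 0 ≤ qBinom q m r :=
  div_nonneg (qFact_pos hq _).le (mul_nonneg (qFact_pos hq _).le (qFact_pos hq _).le)

theorem qBinom_add_zero {q : ℝ} (hq : 0 < q) (n : ℕ) : qBinom q (n + 0) 0 = 1 := by
  have h0 : qFact q 0 = 1 := by simp [qFact]
  rw [qBinom, h0, one_mul, Nat.sub_zero, Nat.add_zero, div_self (qFact_pos hq n).ne']

theorem qBinom_self {q : ℝ} (hq : 0 < q) (k : ℕ) : qBinom q k k = 1 := by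
  have h0 : qFact q 0 = 1 := by simp [qFact]
  rw [qBinom, Nat.sub_self, h0, mul_one, div_self (qFact_pos hq k).ne']

theorem qBinom_pascal {q : ℝ} (hq : 0 < q) (n k : ℕ) :
    qBinom q (n + 1 + (k + 1)) (k + 1) =
      qBinom q (n + (k + 1)) (k + 1) + q ^ (n + 1) * qBinom q (n + 1 + k) k := by
  have hn := (qFact_pos hq n).ne'
  have hk := (qFact_pos hq k).ne'
  have hn1 := (qInt_pos hq n).ne'
  have hk1 := (qInt_pos hq k).ne'
  have e : n + (k + 1) = n + 1 + k := by ring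
  simp only [qBinom, Nat.add_sub_cancel]
  rw [← add_assoc (n + 1) k 1, qFact_succ q (n + 1 + k), add_assoc (n + 1) k 1,
    qInt_add q (n + 1) (k + 1), e, qFact_succ q n, qFact_succ q k]
  field_simp

theorem qBinom_succ_eq_sum {q : ℝ} (hq : 0 < q) (x : ℝ) (n k : ℕ) :
    qBinom q (n + 1 + k) k * x ^ k =
      ∑ i ∈ Finset.range (k + 1), qBinom q (n + i) i * x ^ i * (q ^ (n + 1) * x) ^ (k - i) := by
  induction k with
  | zero => simpa using (qBinom_add_zero hq (n + 1)).trans (qBinom_add_zero hq n).symm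
  | succ k ih =>
    have h : ∑ i ∈ Finset.range (k + 1),
        qBinom q (n + i) i * x ^ i * (q ^ (n + 1) * x) ^ (k + 1 - i) =
        (qBinom q (n + 1 + k) k * x ^ k) * (q ^ (n + 1) * x) := by
      rw [ih, Finset.sum_mul]
      refine Finset.sum_congr rfl fun i hi => ?_
      rw [Nat.sub_add_comm (Nat.lt_succ_iff.mp (Finset.mem_range.mp hi)), pow_succ,
        ← mul_assoc]
    rw [Finset.sum_range_succ, h, qBinom_pascal hq]
    simp
    ring

theorem hasSum_qBinom {q x : ℝ} (hq : 0 < q) (hq1 : q ≤ 1) (hx : 0 ≤ x) (hx1 : x < 1) (n : ℕ) :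
    HasSum (fun k => qBinom q (n + k) k * x ^ k)
      (∏ j ∈ Finset.range (n + 1), (1 - q ^ j * x))⁻¹ := by
  induction n with
  | zero =>
    simpa [qBinom_self hq] using hasSum_geometric_of_lt_one hx hx1
  | succ n ih =>
    have hr : 0 ≤ q ^ (n + 1) * x := by positivity
    have hr1 : q ^ (n + 1) * x < 1 :=
      (mul_le_of_le_one_left hx (pow_le_one₀ hq.le hq1)).trans_lt hx1
    have hg := hasSum_geometric_of_lt_one hr hr1
    have h := hasSum_sum_range_mul_of_summable_norm ih.summable.norm hg.summable.norm
    rw [ih.tsum_eq, hg.tsum_eq, ← mul_inv, ← Finset.prod_range_succ] at h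
    simpa only [qBinom_succ_eq_sum hq] using h

/-- The probability weights of the `q`-Meyer–König–Zeller operator. -/
noncomputable def mkzWeight (q : ℝ) (n : ℕ) (x : ℝ) (k : ℕ) : ℝ :=
  (∏ j ∈ Finset.range (n + 1), (1 - q ^ j * x)) * (qBinom q (n + k) k * x ^ k)

theorem prod_one_sub_pos {q x : ℝ} (hq : 0 < q) (hq1 : q ≤ 1) (hx : 0 ≤ x) (hx1 : x < 1)
    (n : ℕ) : 0 < ∏ j ∈ Finset.range n, (1 - q ^ j * x) :=
  Finset.prod_pos fun _ _ => sub_pos.2 <|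
    (mul_le_of_le_one_left hx (pow_le_one₀ hq.le hq1)).trans_lt hx1

theorem mkzWeight_nonneg {q x : ℝ} (hq : 0 < q) (hq1 : q ≤ 1) (hx : 0 ≤ x) (hx1 : x < 1)
    (n k : ℕ) : 0 ≤ mkzWeight q n x k :=
  mul_nonneg (prod_one_sub_pos hq hq1 hx hx1 _).le
    (mul_nonneg (qBinom_nonneg hq _ _) (pow_nonneg hx k))

theorem hasSum_mkzWeight {q x : ℝ} (hq : 0 < q) (hq1 : q ≤ 1) (hx : 0 ≤ x) (hx1 : x < 1)
    (n : ℕ) : HasSum (mkzWeight q n x) 1 := by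
  have h := (hasSum_qBinom hq hq1 hx hx1 n).mul_left (∏ j ∈ Finset.range (n + 1), (1 - q ^ j * x))
  rwa [mul_inv_cancel₀ (prod_one_sub_pos hq hq1 hx hx1 _).ne'] at h

theorem MKZ_eq_tsum {x : ℝ} (hx1 : x < 1) (q : ℝ) (n : ℕ) (f : ℝ → ℝ) :
    MKZ q n f x = ∑' k, f (qInt q k / qInt q (n + k)) * mkzWeight q n x k := by
  rw [MKZ, if_neg hx1.ne, ← tsum_mul_left]
  exact tsum_congr fun k => by rw [mkzWeight]; ring

theorem mkz_node_mem {q : ℝ} (hq : 0 < q) (n k : ℕ) :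
    qInt q k / qInt q (n + k) ∈ Icc (0 : ℝ) 1 := by
  refine ⟨div_nonneg (qInt_nonneg hq _) (qInt_nonneg hq _),
    div_le_one_of_le₀ ?_ (qInt_nonneg hq _)⟩
  rw [add_comm, qInt_add]
  exact le_add_of_nonneg_right (mul_nonneg (pow_nonneg hq.le _) (qInt_nonneg hq _))

theorem hasSum_MKZ {q x C : ℝ} (hq : 0 < q) (hq1 : q ≤ 1) (hx : 0 ≤ x) (hx1 : x < 1) (n : ℕ)
    {f : ℝ → ℝ} (hf : ∀ t ∈ Icc (0 : ℝ) 1, |f t| ≤ C) :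
    HasSum (fun k => f (qInt q k / qInt q (n + k)) * mkzWeight q n x k) (MKZ q n f x) := by
  rw [MKZ_eq_tsum hx1]
  refine (Summable.of_norm_bounded ((hasSum_mkzWeight hq hq1 hx hx1 n).summable.mul_left C)
    fun k => ?_).hasSum
  have hw := mkzWeight_nonneg hq hq1 hx hx1 n k
  rw [norm_mul, Real.norm_eq_abs, Real.norm_of_nonneg hw]
  exact mul_le_mul_of_nonneg_right (hf _ (mkz_node_mem hq n k)) hw

theorem abs_sub_sq_le_one {x t : ℝ} (hx : x ∈ Icc (0 : ℝ) 1) (ht : t ∈ Icc (0 : ℝ) 1) :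
    |(t - x) ^ 2| ≤ 1 := by
  rw [abs_of_nonneg (sq_nonneg _)]
  exact (sq_le_one_iff_abs_le_one _).2 (abs_le.2 ⟨by linarith [hx.2, ht.1], by linarith [hx.1, ht.2]⟩)

theorem MKZ_sub_sq_mem_Icc {q x : ℝ} (hq : 0 < q) (hq1 : q ≤ 1) (hx : x ∈ Icc (0 : ℝ) 1) (n : ℕ) :
    MKZ q n (fun t => (t - x) ^ 2) x ∈ Icc (0 : ℝ) 1 := by
  rcases hx.2.eq_or_lt with rfl | hx1
  · simp [MKZ]
  · have h := hasSum_MKZ hq hq1 hx.1 hx1 n (f := fun t => (t - x) ^ 2)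
      fun t => abs_sub_sq_le_one hx
    have hw := mkzWeight_nonneg hq hq1 hx.1 hx1 n
    refine ⟨h.nonneg fun k => mul_nonneg (sq_nonneg _) (hw k),
      hasSum_le (fun k => ?_) h (hasSum_mkzWeight hq hq1 hx.1 hx1 n)⟩
    exact mul_le_of_le_one_left (hw k)
      ((le_abs_self _).trans (abs_sub_sq_le_one hx (mkz_node_mem hq n k)))

theorem abs_sub_le_modulus {f : ℝ → ℝ} (hf : ContinuousOn f (Icc 0 1)) {δ x y : ℝ}
    (hx : x ∈ Icc (0 : ℝ) 1) (hy : y ∈ Icc (0 : ℝ) 1) (h : |x - y| ≤ δ) :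
    |f x - f y| ≤ modulus f δ := by
  obtain ⟨C, hC⟩ := isCompact_Icc.exists_bound_of_continuousOn hf
  refine le_csSup ⟨C + C, ?_⟩ ⟨x, y, hx, hy, h, rfl⟩
  rintro _ ⟨s, t, hs, ht, -, rfl⟩
  exact (abs_sub _ _).trans (add_le_add (hC s hs) (hC t ht))

theorem modulus_nonneg (f : ℝ → ℝ) (δ : ℝ) : 0 ≤ modulus f δ :=
  Real.sSup_nonneg (by rintro _ ⟨_, _, _, _, _, rfl⟩; exact abs_nonneg _)

theorem abs_sub_le_nat_mul_modulus {f : ℝ → ℝ} (hf : ContinuousOn f (Icc 0 1)) {δ x y : ℝ}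
    (hx : x ∈ Icc (0 : ℝ) 1) (hy : y ∈ Icc (0 : ℝ) 1) {m : ℕ} (hm : 0 < m)
    (h : |y - x| ≤ m * δ) : |f y - f x| ≤ m * modulus f δ := by
  have hm' : (0 : ℝ) < m := Nat.cast_pos.2 hm
  set p : ℕ → ℝ := fun i => x + (i / m : ℝ) * (y - x) with hp
  have hmem : ∀ i ≤ m, p i ∈ Icc (0 : ℝ) 1 := fun i hi => by
    have h1 : (i / m : ℝ) ≤ 1 := div_le_one_of_le₀ (Nat.cast_le.2 hi) hm'.le
    have := (convex_Icc (0 : ℝ) 1).add_smul_sub_mem hx hy ⟨by positivity, h1⟩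
    simpa [hp] using this
  have hstep : ∀ i < m, |f (p (i + 1)) - f (p i)| ≤ modulus f δ := fun i hi => by
    refine abs_sub_le_modulus hf (hmem _ hi) (hmem _ hi.le) ?_
    have : p (i + 1) - p i = (y - x) / m := by simp only [hp]; push_cast; ring
    rw [this, abs_div, abs_of_pos hm', div_le_iff₀ hm']
    linarith
  have hsum := Finset.abs_sum_le_sum_abs (fun i => f (p (i + 1)) - f (p i)) (Finset.range m)
  rw [Finset.sum_range_sub (fun i => f (p i))] at hsum
  have h0 : p 0 = x := by simp [hp]
  have h1 : p m = y := by simp [hp, div_self hm'.ne']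
  rw [h0, h1] at hsum
  refine hsum.trans ((Finset.sum_le_sum fun i hi => hstep i (Finset.mem_range.1 hi)).trans ?_)
  simp

theorem abs_sub_le_modulus_mul {f : ℝ → ℝ} (hf : ContinuousOn f (Icc 0 1)) {δ x t : ℝ}
    (hδ : 0 < δ) (hx : x ∈ Icc (0 : ℝ) 1) (ht : t ∈ Icc (0 : ℝ) 1) :
    |f t - f x| ≤ modulus f δ * (1 + (t - x) ^ 2 / δ ^ 2) := by
  have hω := modulus_nonneg f δ
  rcases le_or_gt |t - x| δ with h | h
  · exact (abs_sub_le_modulus hf ht hx h).trans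
      (le_mul_of_one_le_right hω (le_add_of_nonneg_right (by positivity)))
  · have h1 : 1 ≤ |t - x| / δ := (one_le_div hδ).2 h.le
    have hm : 0 < ⌈|t - x| / δ⌉₊ := Nat.ceil_pos.2 (zero_lt_one.trans_le h1)
    refine (abs_sub_le_nat_mul_modulus hf hx ht hm ((div_le_iff₀ hδ).1 (Nat.le_ceil _))).trans ?_
    rw [mul_comm]
    refine mul_le_mul_of_nonneg_left ?_ hω
    rw [← sq_abs (t - x), ← div_pow]
    nlinarith [Nat.ceil_lt_add_one (zero_le_one.trans h1)]

theorem abs_MKZ_sub_le {q x δ : ℝ} (hq : 0 < q) (hq1 : q ≤ 1) (hx : x ∈ Icc (0 : ℝ) 1) (n : ℕ)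
    {f : ℝ → ℝ} (hf : ContinuousOn f (Icc 0 1)) (hδ : 0 < δ) :
    |MKZ q n f x - f x| ≤
      modulus f δ * (1 + MKZ q n (fun t => (t - x) ^ 2) x / δ ^ 2) := by
  rcases hx.2.eq_or_lt with rfl | hx1
  · simpa [MKZ] using modulus_nonneg f δ
  · obtain ⟨C, hC⟩ := isCompact_Icc.exists_bound_of_continuousOn hf
    have hw := hasSum_mkzWeight hq hq1 hx.1 hx1 n
    have h2 := hasSum_MKZ hq hq1 hx.1 hx1 n (f := fun t => (t - x) ^ 2)
      fun t => abs_sub_sq_le_one hx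
    have hd := (hasSum_MKZ hq hq1 hx.1 hx1 n hC).sub (hw.mul_left (f x))
    have hb := (hw.add (h2.div_const (δ ^ 2))).mul_left (modulus f δ)
    rw [mul_one] at hd
    rw [← hd.tsum_eq, ← Real.norm_eq_abs]
    refine tsum_of_norm_bounded hb fun k => ?_
    have hk := mkzWeight_nonneg hq hq1 hx.1 hx1 n k
    rw [← sub_mul, norm_mul, Real.norm_of_nonneg hk, Real.norm_eq_abs]
    refine (mul_le_mul_of_nonneg_right
      (abs_sub_le_modulus_mul hf hδ hx (mkz_node_mem hq n k)) hk).trans_eq ?_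
    ring

theorem abel_MKZ_sub_le (q : ℕ → ℝ) (hq : ∀ n : ℕ, 1 ≤ n → 0 < q n ∧ q n ≤ 1) {f : ℝ → ℝ}
    (hf : ContinuousOn f (Icc 0 1)) {y : ℝ} (hy : y ∈ Ioo (0 : ℝ) 1) (hφ : 0 < phiM q y) :
    (1 - y) * ⨆ x : Icc (0 : ℝ) 1,
      |∑' n : ℕ, (MKZ (q (n + 3)) (n + 3) f x - f x) * y ^ (n + 3)| ≤
        2 * modulus f (phiM q y) := by
  have hy1 : 0 < 1 - y := sub_pos.2 hy.2
  set ω := modulus f (phiM q y) with hω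
  have hω0 : 0 ≤ ω := modulus_nonneg f _
  have hgeo := hasSum_geometric_of_lt_one hy.1.le hy.2
  have hpow : HasSum (fun n => y ^ (n + 3)) ((1 - y)⁻¹ * y ^ 3) := by
    simpa only [pow_add] using hgeo.mul_right (y ^ 3)
  have hG : (1 - y)⁻¹ * y ^ 3 ≤ (1 - y)⁻¹ :=
    mul_le_of_le_one_right (inv_nonneg.2 hy1.le) (pow_le_one₀ hy.1.le hy.2.le)
  set B : Icc (0 : ℝ) 1 → ℕ → ℝ := fun x n =>
    MKZ (q (n + 3)) (n + 3) (fun t => (t - (x : ℝ)) ^ 2) x * y ^ (n + 3) with hB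
  have hmem : ∀ (x : Icc (0 : ℝ) 1) (n : ℕ),
      MKZ (q (n + 3)) (n + 3) (fun t => (t - (x : ℝ)) ^ 2) x ∈ Icc (0 : ℝ) 1 := fun x n =>
    MKZ_sub_sq_mem_Icc (hq _ (by omega)).1 (hq _ (by omega)).2 x.2 _
  have hyn : ∀ n, 0 ≤ y ^ (n + 3) := fun n => pow_nonneg hy.1.le _
  have hBle : ∀ x n, B x n ≤ y ^ (n + 3) := fun x n => mul_le_of_le_one_left (hyn n) (hmem x n).2
  have hBsum : ∀ x, Summable (B x) := fun x =>
    Summable.of_nonneg_of_le (fun n => mul_nonneg (hmem x n).1 (hyn n)) (hBle x) hpow.summable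
  have hbdd : BddAbove (range fun x => ∑' n, B x n) := by
    refine ⟨(1 - y)⁻¹ * y ^ 3, ?_⟩
    rintro _ ⟨x, rfl⟩
    exact hasSum_le (hBle x) (hBsum x).hasSum hpow
  set S := ⨆ x, ∑' n, B x n with hS
  have hφS : phiM q y = √((1 - y) * S) := rfl
  have hsq : phiM q y ^ 2 = (1 - y) * S := by
    rw [hφS, Real.sq_sqrt (Real.sqrt_pos.1 (hφS ▸ hφ)).le]
  have hSd : S / phiM q y ^ 2 = (1 - y)⁻¹ := by
    have hS0 : S ≠ 0 := by
      intro h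
      rw [h, mul_zero] at hsq
      exact (pow_pos hφ 2).ne' hsq
    rw [hsq]
    field_simp
  have key : ⨆ x : Icc (0 : ℝ) 1,
      |∑' n : ℕ, (MKZ (q (n + 3)) (n + 3) f x - f x) * y ^ (n + 3)| ≤ ω * (2 * (1 - y)⁻¹) := by
    refine ciSup_le fun x => ?_
    have hb := (hpow.add ((hBsum x).hasSum.div_const (phiM q y ^ 2))).mul_left ω
    have hle : ∑' n, B x n ≤ S := le_ciSup hbdd x
    have h := tsum_of_norm_bounded (f := fun n : ℕ =>
      (MKZ (q (n + 3)) (n + 3) f x - f x) * y ^ (n + 3)) hb fun n => by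
        rw [norm_mul, Real.norm_of_nonneg (hyn n), Real.norm_eq_abs]
        refine (mul_le_mul_of_nonneg_right (abs_MKZ_sub_le (hq _ (by omega)).1
          (hq _ (by omega)).2 x.2 (n + 3) hf hφ) (hyn n)).trans_eq ?_
        simp only [hB]
        ring
    refine h.trans (mul_le_mul_of_nonneg_left ?_ hω0)
    have := div_le_div_of_nonneg_right hle (sq_nonneg (phiM q y))
    rw [hSd] at this
    linarith
  calc _ ≤ (1 - y) * (ω * (2 * (1 - y)⁻¹)) := mul_le_mul_of_nonneg_left key hy1.le
    _ = 2 * ω := by field_simp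


end

theorem stmt16 (q : ℕ → ℝ) (hq : ∀ n : ℕ, 1 ≤ n → 0 < q n ∧ q n ≤ 1)
    (hsum : ∀ y ∈ Set.Ioo (0 : ℝ) 1,
      Summable (fun n : ℕ =>
        (⨆ x : Set.Icc (0 : ℝ) 1, MKZ (q (n + 3)) (n + 3) (fun t => (t - (x : ℝ)) ^ 2) x) *
          y ^ (n + 3)))
    (hφ : ∀ y ∈ Set.Ioo (0 : ℝ) 1, 0 < phiM q y)
    (μ : ℝ → ℝ) (hμ : ∀ y ∈ Set.Ioo (0 : ℝ) 1, 0 < μ y)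
    (f : ℝ → ℝ) (hf : ContinuousOn f (Set.Icc 0 1))
    (hrate : Tendsto (fun y : ℝ => modulus f (phiM q y) / μ y) (𝓝[<] 1) (𝓝 0)) :
    Tendsto (fun y : ℝ =>
        ((1 - y) * ⨆ x : Set.Icc (0 : ℝ) 1,
          |∑' n : ℕ, (MKZ (q (n + 3)) (n + 3) f x - f x) * y ^ (n + 3)|) / μ y)
      (𝓝[<] 1) (𝓝 0) := by
  have hev : ∀ᶠ y : ℝ in 𝓝[<] 1, y ∈ Set.Ioo (0 : ℝ) 1 := Ioo_mem_nhdsLT one_pos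
  refine squeeze_zero' (hev.mono fun y hy => ?_) (hev.mono fun y hy => ?_)
    (by simpa using hrate.const_mul 2)
  · exact div_nonneg (mul_nonneg (sub_nonneg.2 hy.2.le)
      (Real.iSup_nonneg fun _ => abs_nonneg _)) (hμ y hy).le
  · rw [← mul_div_assoc]
    exact div_le_div_of_nonneg_right (abel_MKZ_sub_le q hq hf hy (hφ y hy)) (hμ y hy).le
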